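/- Let K be a number field and S a finite set of prime ideals of O_K. Consider the set of solutions (α, β, γ) ∈ O_S^* × O_S^* × O_S of the equation α + β = γ³. Declare two solutions (α₁, β₁, γ₁) and (α₂, β₂, γ₂) equivalent if there exists ε ∈ O_S^* with α₂ = ε³α₁, β₂ = ε³β₁ and γ₂ = εγ₁. Then the set of solutions has only finitely many equivalence classes under this relation. -/

import Mathlib

open NumberField IsDedekindDomain

/-- `x` is an `S`-unit of `K`. -/
def IsSUnit {K : Type} [Field K] [NumberField K]
    (S : Set (HeightOneSpectrum (𝓞 K))) (x : K) : Prop :=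
  x ≠ 0 ∧ x ∈ S.integer K ∧ x⁻¹ ∈ S.integer K

/-- The set of solutions `(α, β, γ) ∈ O_S^* × O_S^* × O_S` of `α + β = γ ^ i`. -/
def SolSet {K : Type} [Field K] [NumberField K]
    (S : Set (HeightOneSpectrum (𝓞 K))) (i : ℕ) : Type :=
  {t : K × K × K // IsSUnit S t.1 ∧ IsSUnit S t.2.1 ∧
    t.2.2 ∈ S.integer K ∧ t.1 + t.2.1 = t.2.2 ^ i}

/-- The scaling relation `(α₂, β₂, γ₂) = (εⁱα₁, εⁱβ₁, εγ₁)` for some `ε ∈ O_S^*`. -/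
def SolRel {K : Type} [Field K] [NumberField K]
    {S : Set (HeightOneSpectrum (𝓞 K))} {i : ℕ}
    (x y : SolSet S i) : Prop :=
  ∃ ε : K, IsSUnit S ε ∧
    y.1.1 = ε ^ i * x.1.1 ∧ y.1.2.1 = ε ^ i * x.1.2.1 ∧ y.1.2.2 = ε * x.1.2.2

section Pade
open Polynomial Finset

/-- The polynomial `∑ j < n, w j * (1 - X) ^ j`. -/
noncomputable def oneSubExpansion (w : ℕ → ℤ) (n : ℕ) : ℤ[X] :=
  ∑ j ∈ range n, C (w j) * (1 - X) ^ j

lemma coeff_one_sub_X_pow (j r : ℕ) :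
    ((1 - X : ℤ[X]) ^ j).coeff r = (-1) ^ r * j.choose r := by
  have h : (1 - X : ℤ[X]) ^ j = ((1 + X) ^ j).comp (C (-1) * X) := by
    simp [sub_eq_add_neg]
  rw [h, comp_C_mul_X_coeff, coeff_one_add_X_pow, mul_comm]

lemma coeff_oneSubExpansion (w : ℕ → ℤ) (n r : ℕ) :
    (oneSubExpansion w n).coeff r = (-1) ^ r * ∑ j ∈ range n, w j * j.choose r := by
  simp only [oneSubExpansion, finsetSum_coeff, coeff_C_mul, coeff_one_sub_X_pow, mul_sum]
  exact sum_congr rfl fun _ _ ↦ by ring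

lemma natDegree_oneSubExpansion_le (w : ℕ → ℤ) (n : ℕ) :
    (oneSubExpansion w (n + 1)).natDegree ≤ n := by
  refine natDegree_le_iff_coeff_eq_zero.mpr fun r hr ↦ ?_
  rw [coeff_oneSubExpansion, sum_eq_zero, mul_zero]
  intro j hj
  rw [Nat.choose_eq_zero_of_lt (by grind), Nat.cast_zero, mul_zero]

lemma coeff_oneSubExpansion_self (w : ℕ → ℤ) (n : ℕ) :
    (oneSubExpansion w (n + 1)).coeff n = (-1) ^ n * w n := by
  rw [coeff_oneSubExpansion, sum_range_succ, sum_eq_zero, Nat.choose_self]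
  · simp
  · intro j hj
    rw [Nat.choose_eq_zero_of_lt (by grind), Nat.cast_zero, mul_zero]

lemma abs_coeff_oneSubExpansion_le {w : ℕ → ℤ} {n : ℕ} {W : ℤ} (hw : ∀ j < n, |w j| ≤ W) (r : ℕ) :
    |(oneSubExpansion w n).coeff r| ≤ n * (W * 2 ^ n) := by
  rw [coeff_oneSubExpansion, abs_mul, abs_pow, abs_neg, abs_one, one_pow, one_mul]
  refine (abs_sum_le_sum_abs _ _).trans ?_
  refine (sum_le_sum (g := fun _ ↦ W * 2 ^ n) fun j hj ↦ ?_).trans (by simp)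
  have hj : j < n := by simpa using hj
  rw [abs_mul, Nat.abs_cast]
  have h1 : (j.choose r : ℤ) ≤ 2 ^ n := by
    exact_mod_cast (Nat.choose_le_two_pow j r).trans (Nat.pow_le_pow_right two_pos hj.le)
  exact mul_le_mul (hw j hj) h1 (by positivity) ((abs_nonneg _).trans (hw j hj))

/-- The coefficient of `(1 - X) ^ j` in the Padé remainder for `(1 - X) ^ (a + b + 1)` with
numerator and denominator of degrees `a` and `b`. -/
noncomputable def padeWeight (a b j : ℕ) : ℤ :=
  (-1) ^ (a + 2 * b + 1 - j) * (a + 2 * b + 1).choose j * Ring.choose ((j : ℤ) - (a + 1)) b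

lemma sum_padeWeight_mul_choose (a b r : ℕ) (hr : r < a + b + 1) :
    ∑ j ∈ range (a + 2 * b + 1 + 1), padeWeight a b j * j.choose r = 0 := by
  have hdeg : ((descPochhammer ℤ b).comp (X - C ((a : ℤ) + 1)) * descPochhammer ℤ r).natDegree
      < a + 2 * b + 1 := by
    refine natDegree_mul_le.trans_lt ?_
    rw [natDegree_comp, natDegree_X_sub_C, descPochhammer_natDegree, descPochhammer_natDegree]
    omega
  have h := congrFun (fwdDiff_iter_eq_zero_of_degree_lt hdeg) 0
  rw [fwdDiff_iter_eq_sum_shift] at h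
  have hfac : ((b.factorial * r.factorial : ℕ) : ℤ) ≠ 0 := by positivity
  refine (mul_eq_zero.mp ?_).resolve_left hfac
  rw [mul_sum]
  refine Eq.trans (sum_congr rfl fun j _ ↦ ?_) h
  have h1 := Ring.descPochhammer_eq_factorial_smul_choose ((j : ℤ) - (a + 1)) b
  have h2 := Ring.descPochhammer_eq_factorial_smul_choose (j : ℤ) r
  rw [Ring.choose_natCast] at h2
  simp only [eval_mul, eval_comp, eval_sub, eval_X, eval_C, zero_add, nsmul_eq_mul, mul_one,
    smul_eq_mul, padeWeight]
  simp only [nsmul_eq_mul, ← eval_eq_smeval] at h1 h2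
  rw [h1, h2]
  push_cast
  ring

lemma padeWeight_eq_zero {a b j : ℕ} (h1 : a < j) (h2 : j < a + b + 1) : padeWeight a b j = 0 := by
  have : (j : ℤ) - (a + 1) = ((j - (a + 1) : ℕ) : ℤ) := by omega
  rw [padeWeight, this, Ring.choose_natCast, Nat.choose_eq_zero_of_lt (show j - (a + 1) < b by omega)]
  simp

lemma abs_padeWeight_le {a b j : ℕ} (hj : j ≤ a + 2 * b + 1) :
    |padeWeight a b j| ≤ 4 ^ (a + 2 * b + 1) := by
  have h1 : ((a + 2 * b + 1).choose j : ℤ) ≤ 2 ^ (a + 2 * b + 1) := by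
    exact_mod_cast Nat.choose_le_two_pow _ _
  have h2 : |Ring.choose ((j : ℤ) - (a + 1)) b| ≤ 2 ^ (a + 2 * b + 1) := by
    rcases lt_or_ge a j with h | h
    · have : (j : ℤ) - (a + 1) = ((j - (a + 1) : ℕ) : ℤ) := by omega
      rw [this, Ring.choose_natCast, Nat.abs_cast]
      exact_mod_cast (Nat.choose_le_two_pow _ _).trans (Nat.pow_le_pow_right two_pos (by omega))
    · have : (j : ℤ) - (a + 1) = -((a + 1 - j : ℕ) : ℤ) := by omega
      have h3 : ((a + 1 - j : ℕ) : ℤ) + b - 1 = ((a + b - j : ℕ) : ℤ) := by omega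
      have h4 : |((b : ℤ).negOnePow • ((a + b - j).choose b : ℤ))| = (a + b - j).choose b := by
        rcases Int.units_eq_one_or (b : ℤ).negOnePow with h | h <;> simp [h]
      rw [this, Ring.choose_neg, h3, Ring.choose_natCast, h4]
      exact_mod_cast (Nat.choose_le_two_pow _ _).trans (Nat.pow_le_pow_right two_pos (by omega))
  rw [padeWeight, abs_mul, abs_mul, abs_pow, abs_neg, abs_one, one_pow, one_mul, Nat.abs_cast,
    show (4 : ℤ) = 2 * 2 by norm_num, mul_pow]
  gcongr


lemma exists_pade (a b : ℕ) : ∃ A B D : ℤ[X],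
    X ^ (a + b + 1) * A + (1 - X) ^ (a + b + 1) * B + D = 0 ∧
    A.natDegree ≤ b ∧ B.natDegree ≤ b ∧ D.natDegree ≤ a ∧
    B.coeff b ≠ 0 ∧ D.coeff a ≠ 0 ∧
    ∀ r, |A.coeff r| ≤ 2 ^ (4 * (a + 2 * b + 2)) ∧ |B.coeff r| ≤ 2 ^ (4 * (a + 2 * b + 2)) ∧
      |D.coeff r| ≤ 2 ^ (4 * (a + 2 * b + 2)) := by
  set k := a + b + 1 with hk
  set w := padeWeight a b with hw
  set F := oneSubExpansion w (a + 2 * b + 1 + 1) with hF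
  set D := oneSubExpansion w (a + 1) with hD
  set B := oneSubExpansion (fun s ↦ w (k + s)) (b + 1) with hB
  have hsplit : F = D + (1 - X) ^ k * B := by
    simp only [hF, hD, hB, oneSubExpansion, mul_sum]
    rw [show a + 2 * b + 1 + 1 = (a + 1) + b + (b + 1) by ring, sum_range_add, sum_range_add,
      sum_eq_zero (s := range b), add_zero, show a + 1 + b = k by omega]
    · congr 1
      exact sum_congr rfl fun s _ ↦ by rw [pow_add]; ring
    · intro j hj
      rw [hw, padeWeight_eq_zero (by omega) (by have := mem_range.mp hj; omega)]
      simp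
  obtain ⟨Q, hQ⟩ : X ^ k ∣ F := by
    refine X_pow_dvd_iff.mpr fun r hr ↦ ?_
    rw [hF, coeff_oneSubExpansion, hw, sum_padeWeight_mul_choose a b r hr, mul_zero]
  have hbound {u : ℕ → ℤ} {n : ℕ} (hn : n ≤ a + 2 * b + 2)
      (hu : ∀ j < n, |u j| ≤ 4 ^ (a + 2 * b + 1)) (r : ℕ) :
      |(oneSubExpansion u n).coeff r| ≤ 2 ^ (4 * (a + 2 * b + 2)) := by
    refine (abs_coeff_oneSubExpansion_le hu r).trans ?_
    have h1 : (n : ℤ) ≤ 2 ^ (a + 2 * b + 2) := by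
      exact_mod_cast (hn.trans Nat.lt_two_pow_self.le)
    calc (n : ℤ) * (4 ^ (a + 2 * b + 1) * 2 ^ n)
        ≤ 2 ^ (a + 2 * b + 2) * (4 ^ (a + 2 * b + 2) * 2 ^ (a + 2 * b + 2)) := by
          gcongr <;> omega
      _ = 2 ^ (4 * (a + 2 * b + 2)) := by
          rw [show (4 : ℤ) = 2 ^ 2 by norm_num, ← pow_mul, ← pow_add, ← pow_add]
          congr 1
          ring
  have hQcoeff (r : ℕ) : Q.coeff r = F.coeff (r + k) := by rw [hQ, coeff_X_pow_mul]
  refine ⟨-Q, B, D, ?_, ?_, natDegree_oneSubExpansion_le _ _, natDegree_oneSubExpansion_le _ _,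
    ?_, ?_, fun r ↦ ⟨?_, ?_, ?_⟩⟩
  · linear_combination hQ - hsplit
  · rw [natDegree_neg]
    refine natDegree_le_iff_coeff_eq_zero.mpr fun r hr ↦ ?_
    rw [hQcoeff]
    exact coeff_eq_zero_of_natDegree_lt
      ((natDegree_oneSubExpansion_le w (a + 2 * b + 1)).trans_lt (by omega))
  · rw [hB, coeff_oneSubExpansion_self, hw, padeWeight,
      show ((k + b : ℕ) : ℤ) - (a + 1) = ((2 * b : ℕ) : ℤ) by grind, Ring.choose_natCast]
    have h1 := (Nat.choose_pos (show k + b ≤ a + 2 * b + 1 by omega)).ne'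
    have h2 := (Nat.choose_pos (show b ≤ 2 * b by omega)).ne'
    simp [h1, h2]
  · rw [hD, coeff_oneSubExpansion_self, hw, padeWeight,
      show (a : ℤ) - (a + 1) = -1 by ring, Ring.choose_neg,
      show (1 : ℤ) + b - 1 = b by ring, Ring.choose_natCast]
    have h1 := (Nat.choose_pos (show a ≤ a + 2 * b + 1 by omega)).ne'
    rcases Int.units_eq_one_or (b : ℤ).negOnePow with h | h <;> simp [h1, h]
  · rw [coeff_neg, abs_neg, hQcoeff]
    exact hbound le_rfl (fun j hj ↦ abs_padeWeight_le (by omega)) _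
  · exact hbound (by omega) (fun j hj ↦ abs_padeWeight_le (by omega)) _
  · exact hbound (by omega) (fun j hj ↦ abs_padeWeight_le (by omega)) _

lemma eq_C_mul_X_pow {p q : ℤ[X]} {n : ℕ} (h : p = q * X ^ n) (hp : p.natDegree ≤ n) :
    p = C (p.coeff n) * X ^ n := by
  ext r
  rw [coeff_C_mul, coeff_X_pow]
  split_ifs with hr
  · rw [hr, mul_one]
  · rw [mul_zero]
    rcases lt_or_gt_of_ne hr with hr | hr
    · rw [h, coeff_mul_X_pow', if_neg (by omega)]
    · exact coeff_eq_zero_of_natDegree_lt (hp.trans_lt hr)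

/-- Two independent Padé relations between `x ^ (2 * N)`, `(1 - x) ^ (2 * N)` and `1`. -/
lemma exists_independent_pade {N : ℕ} (hN : 1 ≤ N) : ∃ P Q : Fin 3 → ℤ[X],
    (X ^ (2 * N) * P 0 + (1 - X) ^ (2 * N) * P 1 + P 2 = 0) ∧
    (X ^ (2 * N) * Q 0 + (1 - X) ^ (2 * N) * Q 1 + Q 2 = 0) ∧
    (∀ i, (P i).natDegree ≤ N ∧ (Q i).natDegree ≤ N) ∧
    (∀ i r, |(P i).coeff r| ≤ 2 ^ (20 * N) ∧ |(Q i).coeff r| ≤ 2 ^ (20 * N)) ∧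
    ∃ c : ℤ, c ≠ 0 ∧ P 1 * Q 2 - Q 1 * P 2 = C c * X ^ (2 * N) := by
  obtain ⟨M, rfl⟩ : ∃ M, N = M + 1 := ⟨N - 1, by omega⟩
  obtain ⟨A, B, D, h, hA, hB, hD, hB', hD', hc⟩ := exists_pade (M + 1) M
  obtain ⟨A₁, B₁, D₁, h₁, hA₁, hB₁, hD₁, hB₁', hD₁', hc₁⟩ := exists_pade M (M + 1)
  rw [show M + 1 + M + 1 = 2 * (M + 1) by ring] at h
  rw [show M + (M + 1) + 1 = 2 * (M + 1) by ring] at h₁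
  have hpow {z : ℤ} {e : ℕ} (he : e ≤ 20 * (M + 1)) (hz : |z| ≤ 2 ^ e) :
      |z| ≤ 2 ^ (20 * (M + 1)) := hz.trans (pow_le_pow_right₀ (by norm_num) he)
  refine ⟨![A, B, D], ![A₁, B₁, D₁], h, h₁, ?_, ?_, ?_⟩
  · intro i
    fin_cases i <;> simp <;> omega
  · intro i r
    obtain ⟨h1, h2, h3⟩ := hc r
    obtain ⟨h4, h5, h6⟩ := hc₁ r
    fin_cases i
    · exact ⟨hpow (by omega) h1, hpow (by omega) h4⟩
    · exact ⟨hpow (by omega) h2, hpow (by omega) h5⟩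
    · exact ⟨hpow (by omega) h3, hpow (by omega) h6⟩
  · have hE : B * D₁ - B₁ * D = (B₁ * A - B * A₁) * X ^ (2 * (M + 1)) := by
      linear_combination B * h₁ - B₁ * h
    have hdeg : (B * D₁).natDegree < 2 * (M + 1) := natDegree_mul_le.trans_lt (by omega)
    have hdeg' : (B₁ * D).natDegree ≤ 2 * (M + 1) := natDegree_mul_le.trans (by omega)
    have hdegE : (B * D₁ - B₁ * D).natDegree ≤ 2 * (M + 1) :=
      (natDegree_sub_le _ _).trans (max_le hdeg.le hdeg')
    refine ⟨(B * D₁ - B₁ * D).coeff (2 * (M + 1)), ?_, eq_C_mul_X_pow hE hdegE⟩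
    rw [coeff_sub, coeff_eq_zero_of_natDegree_lt hdeg, zero_sub, neg_ne_zero, two_mul,
      coeff_mul_add_eq_of_natDegree_le hB₁ hD]
    exact mul_ne_zero hB₁' hD'

end Pade

section HeightBounds
open Height AdmissibleAbsValues Real

variable {K : Type*} [Field K] [AdmissibleAbsValues K]

lemma logHeight_intCast_le {ι : Type*} [Finite ι] (a : ι → ℤ) {B : ℝ} (hB : 1 ≤ B)
    (h : ∀ i, |(a i : ℝ)| ≤ B) :
    logHeight (fun i ↦ (a i : K)) ≤ totalWeight K * log B := by
  rcases eq_or_ne (fun i ↦ (a i : K)) 0 with h0 | h0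
  · rw [h0, logHeight_zero]
    exact mul_nonneg (Nat.cast_nonneg _) (log_nonneg hB)
  have : Nonempty ι := by
    by_contra hι
    rw [not_nonempty_iff] at hι
    exact h0 (Subsingleton.elim _ _)
  suffices mulHeight (fun i ↦ (a i : K)) ≤ B ^ totalWeight K by
    rw [logHeight_eq_log_mulHeight, ← log_pow]
    exact log_le_log (mulHeight_pos _) this
  rw [mulHeight_eq h0, ← mul_one (B ^ _)]
  refine mul_le_mul ?_ ?_ (finprod_nonneg fun v ↦ Real.iSup_nonneg_of_nonnegHomClass v.val _)
    (by positivity)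
  · rw [totalWeight, ← Multiset.prod_replicate, ← Multiset.map_const']
    refine Multiset.prod_map_le_prod_map₀ _ _
      (fun v _ ↦ Real.iSup_nonneg_of_nonnegHomClass v _) fun v _ ↦ ciSup_le fun i ↦ ?_
    refine le_trans ?_ (h i)
    have h1 := v.apply_nat_le_self (a i).natAbs
    rw [← Int.cast_abs, ← Nat.cast_natAbs]
    rcases Int.natAbs_eq (a i) with h2 | h2 <;> rw [h2] <;> simpa using h1
  · rw [← finprod_one]
    refine finprod_le_finprod (by fun_prop)
      (fun v ↦ Real.iSup_nonneg_of_nonnegHomClass v.val _) (by fun_prop) fun v ↦ ?_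
    exact ciSup_le fun i ↦ (isNonarchimedean _ v.prop).apply_intCast_le_one 

lemma logHeight_pow_tuple_le (x : K) (N : ℕ) :
    logHeight (fun i : Fin (N + 1) ↦ x ^ (i : ℕ)) ≤ N * logHeight₁ x := by
  induction N with
  | zero => simp
  | succ N ih =>
    have h1 : (fun i : Fin (N + 1) ↦ x ^ (i : ℕ)) ≠ 0 := fun h ↦ by
      simpa using congrFun h 0
    have h2 : ![x, 1] ≠ 0 := fun h ↦ by simpa using congrFun h 1
    have h3 := logHeight_comp_le (fun i : Fin (N + 2) ↦
      Fin.cases ((0 : Fin (N + 1)), (1 : Fin 2)) (fun j ↦ (j, 0)) i)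
      (fun p : Fin (N + 1) × Fin 2 ↦ x ^ (p.1 : ℕ) * ![x, 1] p.2)
    rw [logHeight_fun_mul_eq h1 h2, ← logHeight₁_eq_logHeight] at h3
    have h4 : (fun i : Fin (N + 2) ↦ x ^ (i : ℕ)) =
        (fun p : Fin (N + 1) × Fin 2 ↦ x ^ (p.1 : ℕ) * ![x, 1] p.2) ∘
        (fun i : Fin (N + 2) ↦ Fin.cases ((0 : Fin (N + 1)), (1 : Fin 2)) (fun j ↦ (j, 0)) i) := by
      funext i
      refine Fin.cases ?_ (fun j ↦ ?_) i <;> simp [pow_succ]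
    rw [h4]
    push_cast
    linarith

lemma logHeight_triple_le (ξ η : K) : logHeight ![ξ, η, -1] ≤ logHeight₁ ξ + logHeight₁ η := by
  have h1 : ![-ξ, 1] ≠ 0 := fun h ↦ by simpa using congrFun h 1
  have h2 : ![-η, 1] ≠ 0 := fun h ↦ by simpa using congrFun h 1
  have h3 := logHeight_comp_le ![((0 : Fin 2), (1 : Fin 2)), (1, 0), (1, 1)]
    (fun p : Fin 2 × Fin 2 ↦ ![-ξ, 1] p.1 * ![-η, 1] p.2)
  rw [logHeight_fun_mul_eq h1 h2, ← logHeight₁_eq_logHeight, ← logHeight₁_eq_logHeight,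
    logHeight₁_neg, logHeight₁_neg, ← logHeight_neg] at h3
  convert h3 using 2
  funext i
  fin_cases i <;> simp

lemma logHeight_cross_le (σ τ : Fin 3 → K) :
    logHeight (fun k ↦ σ (k + 1) * τ (k + 2) - σ (k + 2) * τ (k + 1)) ≤
      totalWeight K * log 9 + logHeight σ + logHeight τ := by
  rcases eq_or_ne σ 0 with rfl | hσ
  · have := logHeight_nonneg τ
    have : (0 : ℝ) ≤ totalWeight K * log 9 := by positivity
    simp [← Pi.zero_def]
    linarith
  rcases eq_or_ne τ 0 with rfl | hτ
  · have := logHeight_nonneg σ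
    have : (0 : ℝ) ≤ totalWeight K * log 9 := by positivity
    simp [← Pi.zero_def]
    linarith
  let A : Fin 3 × (Fin 3 × Fin 3) → ℤ := fun p ↦
    if p.2 = (p.1 + 1, p.1 + 2) then 1 else if p.2 = (p.1 + 2, p.1 + 1) then -1 else 0
  have hA := logHeight_intCast_le (K := K) A le_rfl fun p ↦ by
    simp only [A]; split_ifs <;> simp
  have h := logHeight_linearMap_apply_le (fun p ↦ (A p : K)) fun p : Fin 3 × Fin 3 ↦ σ p.1 * τ p.2
  rw [logHeight_fun_mul_eq hσ hτ] at h
  have h9 : (Nat.card (Fin 3 × Fin 3) : ℝ) = 9 := by norm_num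
  rw [h9] at h
  rw [log_one, mul_zero] at hA
  have e : (fun k ↦ σ (k + 1) * τ (k + 2) - σ (k + 2) * τ (k + 1)) =
      fun k ↦ ∑ p : Fin 3 × Fin 3, (A (k, p) : K) * (σ p.1 * τ p.2) := by
    funext k
    fin_cases k <;> simp [A, Fintype.sum_prod_type, Fin.sum_univ_three] <;> ring
  rw [e]
  linarith

lemma logHeight₁_le_of_relations {A B C X Y ξ η : K} (h1 : X * A + Y * B + C = 0)
    (h2 : ξ * X + η * Y = 1) (h3 : B + C * η ≠ 0) :
    logHeight₁ X ≤
      totalWeight K * log 9 + logHeight ![A, B, C] + (logHeight₁ ξ + logHeight₁ η) := by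
  have hc := logHeight_cross_le ![A, B, C] ![ξ, η, -1]
  have e : (fun k ↦ ![A, B, C] (k + 1) * ![ξ, η, -1] (k + 2) -
      ![A, B, C] (k + 2) * ![ξ, η, -1] (k + 1)) = (A * η - B * ξ) • ![X, Y, 1] := by
    funext k
    fin_cases k
    · simp
      linear_combination B * h2 - η * h1
    · simp
      linear_combination ξ * h1 - A * h2
    · simp
  have h0 : A * η - B * ξ ≠ 0 := fun h ↦ h3 (by linear_combination η * h1 - B * h2 - X * h)
  rw [e, logHeight_smul_eq_logHeight _ h0] at hc
  have h4 := logHeight_comp_le ![(0 : Fin 3), 2] ![X, Y, 1]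
  have e2 : ![X, Y, 1] ∘ ![(0 : Fin 3), 2] = ![X, 1] := by
    funext i
    fin_cases i <;> simp
  rw [e2, ← logHeight₁_eq_logHeight] at h4
  linarith [logHeight_triple_le ξ η]

open Polynomial in
lemma logHeight_aeval_le (P : Fin 3 → ℤ[X]) {N : ℕ} {B : ℝ} (hB : 1 ≤ B)
    (hd : ∀ i, (P i).natDegree ≤ N) (hP : ∀ i r, |((P i).coeff r : ℝ)| ≤ B) (x : K) :
    logHeight (fun i ↦ aeval x (P i)) ≤
      totalWeight K * (log (N + 1) + log B) + N * logHeight₁ x := by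
  have h := logHeight_linearMap_apply_le
    (fun p : Fin 3 × Fin (N + 1) ↦ (((P p.1).coeff p.2 : ℤ) : K)) (fun i ↦ x ^ (i : ℕ))
  have h1 := logHeight_intCast_le (K := K)
    (fun p : Fin 3 × Fin (N + 1) ↦ (P p.1).coeff p.2) hB fun p ↦ hP _ _
  have h2 := logHeight_pow_tuple_le x N
  have e : (fun i ↦ aeval x (P i)) =
      fun j ↦ ∑ i : Fin (N + 1), (((P j).coeff i : ℤ) : K) * x ^ (i : ℕ) := by
    funext j
    rw [aeval_eq_sum_range' (Nat.lt_succ_of_le (hd j)), Finset.sum_range]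
    simp
  rw [e]
  simp only [Nat.card_eq_fintype_card, Fintype.card_fin, Nat.cast_add, Nat.cast_one] at h
  linarith

open Polynomial in
/-- Padé approximation shows that a solution of `ξ x ^ (2 N) + η y ^ (2 N) = 1` with `x + y = 1`
repels: the heights of `ξ` and `η` control the height of `x`. -/
theorem mul_logHeight₁_le_of_add_eq_one [CharZero K] {x y ξ η : K} {N : ℕ} (hN : 1 ≤ N)
    (hx : x ≠ 0) (hxy : x + y = 1) (h : ξ * x ^ (2 * N) + η * y ^ (2 * N) = 1) :
    N * logHeight₁ x ≤ 30 * totalWeight K * N + (logHeight₁ ξ + logHeight₁ η) := by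
  obtain ⟨P, Q, hP, hQ, hd, hc, c, hc0, hPQ⟩ := exists_independent_pade hN
  have key : ∀ R : Fin 3 → ℤ[X], (X ^ (2 * N) * R 0 + (1 - X) ^ (2 * N) * R 1 + R 2 = 0) →
      (∀ i, (R i).natDegree ≤ N) → (∀ i r, |(R i).coeff r| ≤ 2 ^ (20 * N)) →
      aeval x (R 1) + aeval x (R 2) * η ≠ 0 →
      N * logHeight₁ x ≤ 30 * totalWeight K * N + (logHeight₁ ξ + logHeight₁ η) := by
    intro R hR hRd hRc hne
    have h1 : x ^ (2 * N) * aeval x (R 0) + y ^ (2 * N) * aeval x (R 1) + aeval x (R 2) = 0 := by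
      have := congrArg (aeval x) hR
      simpa [show 1 - x = y by rw [← hxy]; ring] using this
    have h2 := logHeight₁_le_of_relations h1 h hne
    have h3 := logHeight_aeval_le (K := K) R (B := 2 ^ (20 * N)) (one_le_pow₀ (by norm_num)) hRd
      (fun i r ↦ by exact_mod_cast hRc i r) x
    have e : ![aeval x (R 0), aeval x (R 1), aeval x (R 2)] = fun i ↦ aeval x (R i) := by
      funext i
      fin_cases i <;> rfl
    rw [e, logHeight₁_pow] at h2
    have hN' : (1 : ℝ) ≤ N := by exact_mod_cast hN
    have h4 : log 9 + (log (N + 1) + log (2 ^ (20 * N))) ≤ 30 * (N : ℝ) := by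
      have a1 : log 9 ≤ 9 - 1 := log_le_sub_one_of_pos (by norm_num)
      have a2 : log ((N : ℝ) + 1) ≤ N + 1 - 1 := log_le_sub_one_of_pos (by positivity)
      have a3 : log 2 ≤ 2 - 1 := log_le_sub_one_of_pos (by norm_num)
      rw [log_pow]
      push_cast
      nlinarith
    have h5 := mul_le_mul_of_nonneg_left h4 (Nat.cast_nonneg (α := ℝ) (totalWeight K))
    push_cast at h2
    linarith
  by_cases h1 : aeval x (P 1) + aeval x (P 2) * η = 0
  · refine key Q hQ (fun i ↦ (hd i).2) (fun i r ↦ (hc i r).2) fun h2 ↦ ?_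
    have h3 := congrArg (aeval x) hPQ
    simp only [map_sub, map_mul, aeval_X_pow, eq_intCast, map_intCast] at h3
    have h4 : (c : K) * x ^ (2 * N) = 0 := by
      rw [← h3]
      linear_combination aeval x (Q 2) * h1 - aeval x (P 2) * h2
    simp [hc0, hx] at h4
  · exact key P hP (fun i ↦ (hd i).1) (fun i r ↦ (hc i r).1) h1

end HeightBounds

/-- A gap principle: a set whose elements repel each other, in the sense that `f b` cannot be close
to large even multiples of `f a`, and which has finitely many elements in each ball, is finite. -/
theorem Set.finite_of_repelling {α E : Type*} [NormedAddCommGroup E] [NormedSpace ℝ E]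
    [FiniteDimensional ℝ E] (f : α → E) (W : Set α) (hfin : ∀ B, {a ∈ W | ‖f a‖ ≤ B}.Finite)
    {C D : ℝ} (hC : 0 ≤ C) (hD : 0 ≤ D)
    (h : ∀ a ∈ W, ∀ b ∈ W, ∀ N : ℕ, 1 ≤ N →
      N * ‖f a‖ ≤ C * N + D * ‖f b - (2 * N : ℝ) • f a‖) : W.Finite := by
  by_contra hW
  set e : ℝ := 1 / (24 * (D + 1)) with he
  have he0 : 0 < e := by positivity
  have heD : 6 * e * D ≤ 1 / 4 := by
    rw [he]
    field_simp
    linarith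
  obtain ⟨t, hts, htf, hcov⟩ := (isCompact_sphere (0 : E) 1).finite_cover_balls he0
  let V : E → Set α := fun x ↦ {a ∈ W | 2 * C < ‖f a‖ ∧ ‖f a - ‖f a‖ • x‖ ≤ e * ‖f a‖}
  have hV : ∃ x ∈ t, (V x).Infinite := by
    by_contra! hV
    refine hW (((hfin (2 * C)).union (htf.biUnion hV)).subset fun a ha ↦ ?_)
    rcases le_or_gt ‖f a‖ (2 * C) with h1 | h1
    · exact Or.inl ⟨ha, h1⟩
    have h0 : 0 < ‖f a‖ := lt_of_le_of_lt (by positivity) h1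
    have hs : ‖f a‖⁻¹ • f a ∈ Metric.sphere (0 : E) 1 := by
      simp [norm_smul, h0.ne']
    obtain ⟨x, hx, hax⟩ := Set.mem_iUnion₂.1 (hcov hs)
    refine Or.inr (Set.mem_iUnion₂.2 ⟨x, hx, ha, h1, ?_⟩)
    rw [mem_ball_iff_norm] at hax
    have e1 : f a - ‖f a‖ • x = ‖f a‖ • (‖f a‖⁻¹ • f a - x) := by
      rw [smul_sub, smul_inv_smul₀ h0.ne']
    rw [e1, norm_smul, norm_norm, mul_comm]
    gcongr
  obtain ⟨x, hx, hVx⟩ := hV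
  have hx1 : ‖x‖ = 1 := by simpa using hts hx
  obtain ⟨a, haW, ha, hax⟩ := hVx.nonempty
  set ρ := ‖f a‖
  have hρ : 0 < ρ := lt_of_le_of_lt (by positivity) ha
  obtain ⟨b, ⟨hbW, -, hbx⟩, hb⟩ := hVx.exists_notMem_finite (hfin (2 * ρ * (8 * D + 2)))
  have hb : 2 * ρ * (8 * D + 2) < ‖f b‖ := by
    by_contra! hb'
    exact hb ⟨hbW, hb'⟩
  set ρ' := ‖f b‖
  have hN1 := Nat.floor_le (show 0 ≤ ρ' / (2 * ρ) by positivity)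
  have hN2 := Nat.lt_floor_add_one (ρ' / (2 * ρ))
  set N := ⌊ρ' / (2 * ρ)⌋₊
  rw [le_div_iff₀ (by positivity)] at hN1
  have hN3 : 8 * D + 2 < ρ' / (2 * ρ) := by
    rw [lt_div_iff₀ (by positivity)]
    linarith
  rw [div_lt_iff₀ (by positivity)] at hN2
  have hN4 : 8 * D + 1 < N := by
    rw [lt_div_iff₀ (by positivity)] at hN3
    have := lt_of_mul_lt_mul_right (hN3.trans hN2) (by positivity)
    linarith
  have hN : 1 < (N : ℝ) := by linarith
  have h1 := h a haW b hbW N (by exact_mod_cast hN.le)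
  have h2 : ‖f b - (2 * N : ℝ) • f a‖ ≤ e * ρ' + (ρ' - 2 * N * ρ) + 2 * N * (e * ρ) := by
    have e1 : f b - (2 * N : ℝ) • f a =
        (f b - ρ' • x) + (ρ' - 2 * N * ρ) • x - (2 * N : ℝ) • (f a - ρ • x) := by module
    rw [e1]
    refine (norm_sub_le _ _).trans (add_le_add ((norm_add_le _ _).trans (add_le_add hbx ?_)) ?_)
    · rw [norm_smul, hx1, mul_one, Real.norm_of_nonneg (by linarith)]
    · rw [norm_smul, Real.norm_of_nonneg (by positivity)]
      gcongr
  have h3 : e * ρ' + (ρ' - 2 * N * ρ) + 2 * N * (e * ρ) ≤ 6 * e * (N * ρ) + 2 * ρ := by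
    have := mul_le_mul_of_nonneg_left hN2.le he0.le
    have : e * ρ ≤ e * ρ * N := le_mul_of_one_le_right (by positivity) hN.le
    linarith
  have h4 : D * ‖f b - (2 * N : ℝ) • f a‖ ≤ 1 / 4 * (N * ρ) + 2 * D * ρ := by
    have := mul_le_mul_of_nonneg_left (h2.trans h3) hD
    have := mul_le_mul_of_nonneg_right heD (show 0 ≤ N * ρ by positivity)
    linarith
  have h5 : 8 * D * ρ ≤ N * ρ := by gcongr; linarith
  have h6 : N * (2 * C) < N * ρ := by gcongr
  linarith

section UnitEquation
open Height Real

variable {L : Type*} [Field L] [NumberField L]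

/-- The logarithmic embedding attached to a finite set `T` of finite places. -/
noncomputable def logEmbedding (T : Finset (FinitePlace L)) (x : L) : InfinitePlace L ⊕ T → ℝ :=
  Sum.elim (fun v ↦ v.mult * log (v x)) (fun v ↦ log (v.1 x))

variable {T : Finset (FinitePlace L)} {x y : L}

lemma logEmbedding_mul (hx : x ≠ 0) (hy : y ≠ 0) :
    logEmbedding T (x * y) = logEmbedding T x + logEmbedding T y := by
  funext i
  rcases i with v | v
  · simp [logEmbedding, log_mul, hx, hy, mul_add]
  · simp [logEmbedding, log_mul, hx, hy]

lemma logEmbedding_inv : logEmbedding T x⁻¹ = -logEmbedding T x := by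
  funext i
  rcases i with v | v <;> simp [logEmbedding]

lemma logEmbedding_pow (n : ℕ) : logEmbedding T (x ^ n) = (n : ℝ) • logEmbedding T x := by
  funext i
  rcases i with v | v
  · simp [logEmbedding]; ring
  · simp [logEmbedding]

lemma logHeight₁_eq_sum_logEmbedding (hx : ∀ v ∉ T, v x = 1) :
    logHeight₁ x = ∑ i, max 0 (logEmbedding T x i) := by
  rw [NumberField.logHeight₁_eq, Fintype.sum_sum_type]
  congr 1
  · refine Finset.sum_congr rfl fun v _ ↦ ?_
    simp [logEmbedding, posLog, mul_max_of_nonneg]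
  · rw [finsum_eq_sum_of_support_subset (s := T), ← Finset.sum_coe_sort]
    · rfl
    · intro v hv
      by_contra h
      exact hv (by simp [hx v h])

lemma norm_logEmbedding_le (hx : ∀ v ∉ T, v x = 1) : ‖logEmbedding T x‖ ≤ logHeight₁ x := by
  have key : ∀ z : L, (∀ v ∉ T, v z = 1) → ∀ i, logEmbedding T z i ≤ logHeight₁ z := by
    intro z hz i
    rw [logHeight₁_eq_sum_logEmbedding hz]
    exact (le_max_right 0 _).trans
      (Finset.single_le_sum (f := fun i ↦ max 0 (logEmbedding T z i))
        (fun _ _ ↦ le_max_left _ _) (Finset.mem_univ i))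
  rw [pi_norm_le_iff_of_nonneg (zero_le_logHeight₁ x)]
  refine fun i ↦ abs_le.2 ⟨?_, key x hx i⟩
  have := key x⁻¹ (fun v hv ↦ by simp [hx v hv]) i
  rw [logHeight₁_inv, logEmbedding_inv, Pi.neg_apply] at this
  linarith

lemma logHeight₁_le_norm_logEmbedding (hx : ∀ v ∉ T, v x = 1) :
    logHeight₁ x ≤ Fintype.card (InfinitePlace L ⊕ T) * ‖logEmbedding T x‖ := by
  rw [logHeight₁_eq_sum_logEmbedding hx]
  refine (Finset.sum_le_card_nsmul _ _ ‖logEmbedding T x‖ fun i _ ↦ ?_).trans_eq (by simp)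
  exact max_le (norm_nonneg _) ((Real.le_norm_self _).trans (norm_le_pi_norm (logEmbedding T x) i))

lemma logHeight₁_div_pow_le (hx : ∀ v ∉ T, v x = 1) (hy : ∀ v ∉ T, v y = 1) (hx0 : x ≠ 0)
    (hy0 : y ≠ 0) (n : ℕ) :
    logHeight₁ (y / x ^ n) ≤ Fintype.card (InfinitePlace L ⊕ T) *
      ‖logEmbedding T y - (n : ℝ) • logEmbedding T x‖ := by
  have h : logEmbedding T (y / x ^ n) = logEmbedding T y - (n : ℝ) • logEmbedding T x := by
    rw [div_eq_mul_inv, logEmbedding_mul hy0 (inv_ne_zero (pow_ne_zero _ hx0)), logEmbedding_inv,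
      logEmbedding_pow, sub_eq_add_neg]
  rw [← h]
  exact logHeight₁_le_norm_logEmbedding fun v hv ↦ by simp [hx v hv, hy v hv]

/-- The unit equation `x + y = 1` has finitely many solutions in `T`-units. -/
theorem finite_unitEquation (T : Finset (FinitePlace L)) :
    {x : L | x ≠ 0 ∧ 1 - x ≠ 0 ∧ ∀ v ∉ T, v x = 1 ∧ v (1 - x) = 1}.Finite := by
  let c : ℝ := (Fintype.card (InfinitePlace L ⊕ T) : ℕ)
  let t : ℝ := totalWeight L
  refine Set.finite_of_repelling (fun x ↦ (logEmbedding T x, logEmbedding T (1 - x))) _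
    (fun B ↦ ?_) (C := 31 * t) (D := 2 * c) (by positivity) (by positivity) ?_
  · refine (NumberField.finite_setOfPred_logHeight₁_le (K := L) (c * B)).subset ?_
    rintro x ⟨⟨-, -, hx⟩, hB⟩
    refine (logHeight₁_le_norm_logEmbedding fun v hv ↦ (hx v hv).1).trans ?_
    gcongr
    exact (norm_fst_le (logEmbedding T x, logEmbedding T (1 - x))).trans hB
  · rintro x ⟨hx0, hx1, hx⟩ y ⟨hy0, hy1, hy⟩ N hN
    have h1 := mul_logHeight₁_le_of_add_eq_one hN hx0 (add_sub_cancel x 1)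
      (ξ := y / x ^ (2 * N)) (η := (1 - y) / (1 - x) ^ (2 * N)) (by field_simp; ring)
    have h2 := logHeight₁_div_pow_le (fun v hv ↦ (hx v hv).1) (fun v hv ↦ (hy v hv).1)
      hx0 hy0 (2 * N)
    have h3 := logHeight₁_div_pow_le (fun v hv ↦ (hx v hv).2) (fun v hv ↦ (hy v hv).2)
      hx1 hy1 (2 * N)
    set F : (InfinitePlace L ⊕ T → ℝ) × (InfinitePlace L ⊕ T → ℝ) :=
      (logEmbedding T y, logEmbedding T (1 - y)) -
        (2 * N : ℝ) • (logEmbedding T x, logEmbedding T (1 - x)) with hF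
    have h4 : c * ‖logEmbedding T y - ((2 * N : ℕ) : ℝ) • logEmbedding T x‖ ≤ c * ‖F‖ := by
      gcongr
      push_cast
      exact norm_fst_le F
    have h5 : c * ‖logEmbedding T (1 - y) - ((2 * N : ℕ) : ℝ) • logEmbedding T (1 - x)‖ ≤
        c * ‖F‖ := by
      gcongr
      push_cast
      exact norm_snd_le F
    have h6 : ‖(logEmbedding T x, logEmbedding T (1 - x))‖ ≤ logHeight₁ x + t := by
      refine norm_prod_le_iff.2 ⟨?_, ?_⟩
      · exact (norm_logEmbedding_le fun v hv ↦ (hx v hv).1).trans (by simp [t])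
      · refine (norm_logEmbedding_le fun v hv ↦ (hx v hv).2).trans ?_
        have a1 := logHeight₁_sub_le 1 x
        have a2 : log 2 ≤ 2 - 1 := log_le_sub_one_of_pos (by norm_num)
        have a3 := mul_le_mul_of_nonneg_left a2 (Nat.cast_nonneg (α := ℝ) (totalWeight L))
        rw [logHeight₁_one] at a1
        simp only [t]
        linarith
    have h7 := mul_le_mul_of_nonneg_left h6 (Nat.cast_nonneg (α := ℝ) N)
    simp only [t, c] at *
    linarith

end UnitEquation

section SUnits

variable {K : Type} [Field K] [NumberField K] {S : Set (HeightOneSpectrum (𝓞 K))}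

lemma IsSUnit.valuation_eq_one {x : K} (hx : IsSUnit S x) {v : HeightOneSpectrum (𝓞 K)}
    (hv : v ∉ S) : v.valuation K x = 1 := by
  refine le_antisymm (hx.2.1 v hv) ?_
  have h := hx.2.2 v hv
  rw [map_inv₀] at h
  exact (inv_le_one₀ (zero_lt_iff.2 ((Valuation.ne_zero_iff _).2 hx.1))).1 h

lemma isSUnit_iff_exists_mem_unit {x : K} : IsSUnit S x ↔ ∃ u ∈ S.unit K, (u : K) = x := by
  constructor
  · exact fun hx ↦ ⟨Units.mk0 x hx.1, fun v hv ↦ hx.valuation_eq_one hv, rfl⟩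
  · rintro ⟨u, hu, rfl⟩
    exact ⟨u.ne_zero, fun v hv ↦ (hu v hv).le, fun v hv ↦ by rw [map_inv₀, hu v hv, inv_one]⟩

lemma IsSUnit.mul {x y : K} (hx : IsSUnit S x) (hy : IsSUnit S y) : IsSUnit S (x * y) := by
  obtain ⟨u, hu, rfl⟩ := isSUnit_iff_exists_mem_unit.1 hx
  obtain ⟨w, hw, rfl⟩ := isSUnit_iff_exists_mem_unit.1 hy
  exact isSUnit_iff_exists_mem_unit.2 ⟨u * w, mul_mem hu hw, Units.val_mul _ _⟩

lemma IsSUnit.inv {x : K} (hx : IsSUnit S x) : IsSUnit S x⁻¹ := by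
  obtain ⟨u, hu, rfl⟩ := isSUnit_iff_exists_mem_unit.1 hx
  exact isSUnit_iff_exists_mem_unit.2 ⟨u⁻¹, inv_mem hu, Units.val_inv_eq_inv_val _⟩

/-- The group of `S`-units of a number field is finitely generated. -/
lemma finite_additive_unit (hS : S.Finite) : Module.Finite ℤ (Additive (S.unit K)) := by
  have := hS.to_subtype
  let f : Additive (S.unit K) →ₗ[ℤ] (S → ℤ) := AddMonoidHom.toIntLinearMap
    { toFun := fun u v ↦ Multiplicative.toAdd (v.1.valuationOfNeZero (u.toMul : Kˣ))
      map_zero' := by ext; simp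
      map_add' := fun _ _ ↦ by ext; simp }
  let g : Additive (𝓞 K)ˣ →ₗ[ℤ] Additive (S.unit K) := AddMonoidHom.toIntLinearMap
    (MonoidHom.toAdditive ((Units.map (algebraMap (𝓞 K) K : 𝓞 K →* K)).codRestrict (S.unit K)
      fun u v _ ↦ by
        rw [← v.valuationOfNeZero_eq, HeightOneSpectrum.valuation_of_unit_eq, WithZero.coe_one]))
  rw [Module.finite_def]
  refine Submodule.fg_of_fg_map_of_fg_inf_ker f (IsNoetherian.noetherian _) ?_
  refine Submodule.FG.of_le (T := LinearMap.range g) (Module.Finite.iff_fg.1 inferInstance) ?_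
  rintro u ⟨-, hu⟩
  obtain ⟨⟨u, huS⟩, rfl⟩ := Additive.ofMul.surjective u
  have h1 : ∀ v : HeightOneSpectrum (𝓞 K), v.valuation K u = 1 := by
    intro v
    by_cases hv : v ∈ S
    · have h := congrFun (LinearMap.mem_ker.1 hu) ⟨v, hv⟩
      have h2 : v.valuationOfNeZero u = 1 := Multiplicative.toAdd.injective h
      rw [← v.valuationOfNeZero_eq, h2, WithZero.coe_one]
    · exact huS v hv
  obtain ⟨a, ha⟩ := HeightOneSpectrum.mem_integers_of_valuation_le_one K (u : K)
    fun v ↦ (h1 v).le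
  obtain ⟨b, hb⟩ := HeightOneSpectrum.mem_integers_of_valuation_le_one K ((u⁻¹ : Kˣ) : K)
    fun v ↦ by rw [Units.val_inv_eq_inv_val, map_inv₀, h1 v, inv_one]
  have hab : a * b = 1 := RingOfIntegers.coe_injective (by
    rw [map_mul, ha, hb, map_one, Units.mul_inv])
  refine ⟨Additive.ofMul (Units.mkOfMulEqOne a b hab), ?_⟩
  refine congrArg Additive.ofMul (Subtype.ext (Units.ext ?_))
  exact ha

/-- The `S`-units have finitely many classes modulo `n`-th powers. -/
lemma exists_finite_isSUnit_mod_pow (hS : S.Finite) {n : ℕ} (hn : n ≠ 0) :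
    ∃ R : Set K, R.Finite ∧ (∀ a ∈ R, IsSUnit S a) ∧
      ∀ x, IsSUnit S x → ∃ a ∈ R, ∃ u, IsSUnit S u ∧ x = a * u ^ n := by
  have := finite_additive_unit hS
  let P : Submodule ℤ (Additive (S.unit K)) :=
    LinearMap.range (LinearMap.lsmul ℤ (Additive (S.unit K)) n)
  have : Finite (Additive (S.unit K) ⧸ P) := by
    refine Module.finite_of_fg_torsion _ fun {x} ↦ ?_
    obtain ⟨x, rfl⟩ := P.mkQ_surjective x
    refine ⟨⟨n, mem_nonZeroDivisors_of_ne_zero (by exact_mod_cast hn)⟩, ?_⟩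
    rw [Submonoid.mk_smul, ← map_smul, Submodule.mkQ_apply, Submodule.Quotient.mk_eq_zero]
    exact ⟨x, rfl⟩
  refine ⟨Set.range fun q : Additive (S.unit K) ⧸ P ↦ ((q.out.toMul : Kˣ) : K),
    Set.finite_range _, ?_, ?_⟩
  · rintro _ ⟨q, rfl⟩
    exact isSUnit_iff_exists_mem_unit.2 ⟨_, q.out.toMul.2, rfl⟩
  · intro x hx
    obtain ⟨u, hu, rfl⟩ := isSUnit_iff_exists_mem_unit.1 hx
    let q : Additive (S.unit K) ⧸ P := Submodule.Quotient.mk (Additive.ofMul ⟨u, hu⟩)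
    have hq : Submodule.Quotient.mk (Additive.ofMul (⟨u, hu⟩ : S.unit K)) =
      (Submodule.Quotient.mk q.out : Additive (S.unit K) ⧸ P) := (Quotient.out_eq q).symm
    rw [Submodule.Quotient.eq] at hq
    obtain ⟨w, hw⟩ := hq
    refine ⟨_, ⟨q, rfl⟩, ((w.toMul : Kˣ) : K), isSUnit_iff_exists_mem_unit.2 ⟨_, w.toMul.2, rfl⟩, ?_⟩
    have h1 : (⟨u, hu⟩ : S.unit K) = q.out.toMul * w.toMul ^ n := by
      have h2 : Additive.ofMul (⟨u, hu⟩ : S.unit K) = q.out + (n : ℤ) • w := by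
        rw [eq_add_of_sub_eq' hw.symm]
        rfl
      have h3 := congrArg Additive.toMul h2
      simpa using h3
    have h4 := congrArg (fun z : S.unit K ↦ ((z : Kˣ) : K)) h1
    simpa using h4

end SUnits

section Finiteness

variable {K : Type} [Field K] [NumberField K] {S : Set (HeightOneSpectrum (𝓞 K))}

/-- A nonzero algebraic integer a power of which clears the denominator of any `S`-integer. -/
lemma exists_pow_mul_mem_range (hS : S.Finite) : ∃ m : 𝓞 K, m ≠ 0 ∧ ∀ x ∈ S.integer K,
    ∃ (n : ℕ) (y : 𝓞 K), algebraMap (𝓞 K) K m ^ n * x = algebraMap (𝓞 K) K y := by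
  choose f hf hf0 using fun v : HeightOneSpectrum (𝓞 K) ↦
    Submodule.exists_mem_ne_zero_of_ne_bot v.ne_bot
  have hm0 : ∏ v ∈ hS.toFinset, f v ≠ 0 := Finset.prod_ne_zero_iff.2 fun v _ ↦ hf0 v
  set m := ∏ v ∈ hS.toFinset, f v
  have hm : ∀ v ∈ S, v.valuation K (algebraMap (𝓞 K) K m) < 1 := fun v hv ↦
    (v.valuation_lt_one_iff_mem m).2
      (Ideal.mem_of_dvd _ (Finset.dvd_prod_of_mem f (hS.mem_toFinset.2 hv)) (hf v))
  have hmK : algebraMap (𝓞 K) K m ≠ 0 := by simpa using hm0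
  refine ⟨m, hm0, fun x hx ↦ ?_⟩
  have h1 : ∀ v ∈ S, ∃ n : ℕ, v.valuation K (algebraMap (𝓞 K) K m ^ n * x) ≤ 1 := by
    intro v hv
    have h0 : 0 < v.valuation K (algebraMap (𝓞 K) K m) :=
      zero_lt_iff.2 ((Valuation.ne_zero_iff _).2 hmK)
    obtain ⟨n, hn⟩ := MulArchimedean.arch (v.valuation K x) ((one_lt_inv₀ h0).2 (hm v hv))
    refine ⟨n, ?_⟩
    rw [map_mul, map_pow]
    rw [inv_pow] at hn
    calc _ ≤ v.valuation K (algebraMap (𝓞 K) K m) ^ n *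
        (v.valuation K (algebraMap (𝓞 K) K m) ^ n)⁻¹ := by gcongr
      _ = 1 := mul_inv_cancel₀ (pow_ne_zero _ h0.ne')
  choose! n hn using h1
  obtain ⟨y, hy⟩ := HeightOneSpectrum.mem_integers_of_valuation_le_one K
    (algebraMap (𝓞 K) K m ^ (∑ v ∈ hS.toFinset, n v) * x) fun v ↦ by
      by_cases hv : v ∈ S
      · have h2 : n v ≤ ∑ v ∈ hS.toFinset, n v :=
          Finset.single_le_sum (fun _ _ ↦ Nat.zero_le _) (hS.mem_toFinset.2 hv)
        rw [← Nat.sub_add_cancel h2, pow_add, mul_assoc, map_mul, map_pow]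
        exact mul_le_one' (pow_le_one' (v.valuation_le_one m) _) (hn v hv)
      · rw [map_mul, map_pow]
        exact mul_le_one' (pow_le_one' (v.valuation_le_one m) _) (hx v hv)
  exact ⟨_, y, hy.symm⟩

lemma NumberField.FinitePlace.apply_coe_le_one {L : Type*} [Field L] [NumberField L]
    (w : FinitePlace L) (y : 𝓞 L) : w (algebraMap (𝓞 L) L y) ≤ 1 := by
  rw [← FinitePlace.norm_embedding_eq]
  exact FinitePlace.norm_le_one L _ y

/-- Outside a finite set of finite places of an extension, all `S`-integers are integral. -/
lemma exists_finset_finitePlace_le_one (hS : S.Finite) (L : Type*) [Field L] [NumberField L]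
    [Algebra K L] : ∃ T : Finset (FinitePlace L), ∀ w ∉ T, ∀ x ∈ S.integer K,
      w (algebraMap K L x) ≤ 1 := by
  obtain ⟨m, hm0, hm⟩ := exists_pow_mul_mem_range hS
  have hmL : algebraMap K L (algebraMap (𝓞 K) K m) ≠ 0 := by simpa using hm0
  refine ⟨Set.Finite.toFinset (FinitePlace.hasFiniteMulSupport hmL), fun w hw x hx ↦ ?_⟩
  have hw1 : w (algebraMap K L (algebraMap (𝓞 K) K m)) = 1 := by
    by_contra h
    exact hw ((Set.Finite.mem_toFinset _).2 h)
  obtain ⟨n, y, hy⟩ := hm x hx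
  have h1 := congrArg (fun z ↦ w (algebraMap K L z)) hy
  simp only [map_mul, map_pow, hw1, one_pow, one_mul] at h1
  rw [h1]
  exact w.apply_coe_le_one (algebraMap (𝓞 K) (𝓞 L) y)

open Polynomial in
lemma exists_numberField_cube_root (a : K) : ∃ (L : Type) (_ : Field L) (_ : NumberField L)
    (_ : Algebra K L) (θ ζ : L), θ ^ 3 = algebraMap K L a ∧ ζ ^ 2 + ζ + 1 = 0 := by
  let p : K[X] := X ^ 3 - C a
  let q : K[X] := X ^ 2 + X + 1
  have hp : p.natDegree = 3 := natDegree_X_pow_sub_C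
  have hq : q.natDegree = 2 := by simp only [q]; compute_degree!
  have hp0 : p ≠ 0 := fun h ↦ by simp [h] at hp
  have hq0 : q ≠ 0 := fun h ↦ by simp [h] at hq
  let L := SplittingField (p * q)
  have hL : ((p * q).map (algebraMap K L)).Splits := SplittingField.splits (p * q)
  have hpq : (p * q).map (algebraMap K L) ≠ 0 := by
    rw [Polynomial.map_ne_zero_iff (algebraMap K L).injective]
    exact mul_ne_zero hp0 hq0
  obtain ⟨θ, hθ⟩ := (hL.of_dvd hpq (Polynomial.map_dvd _ (dvd_mul_right p q))).exists_eval_eq_zero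
    (by rw [degree_map]; exact (natDegree_pos_iff_degree_pos.1 (by omega)).ne')
  obtain ⟨ζ, hζ⟩ := (hL.of_dvd hpq (Polynomial.map_dvd _ (dvd_mul_left q p))).exists_eval_eq_zero
    (by rw [degree_map]; exact (natDegree_pos_iff_degree_pos.1 (by omega)).ne')
  refine ⟨L, inferInstance, NumberField.of_module_finite K L, inferInstance, θ, ζ, ?_, ?_⟩
  · simpa [p, sub_eq_zero] using hθ
  · simpa [q] using hζ

lemma eq_one_of_mul_mul_eq_one {a b c : ℝ} (ha : 0 ≤ a) (hb : 0 ≤ b) (hc : 0 ≤ c) (ha1 : a ≤ 1)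
    (hb1 : b ≤ 1) (hc1 : c ≤ 1) (h : a * b * c = 1) : a = 1 ∧ b = 1 ∧ c = 1 := by
  have h1 : a * b ≤ 1 := mul_le_one₀ ha1 hb hb1
  have h2 : c = 1 := le_antisymm hc1 (by nlinarith)
  rw [h2, mul_one] at h
  refine ⟨le_antisymm ha1 ?_, le_antisymm hb1 ?_, h2⟩ <;> nlinarith

/-- For a fixed class `a` modulo cubes, the ratios `β / α` take finitely many values. -/
lemma finite_ratios (hS : S.Finite) {a : K} (ha : IsSUnit S a) :
    {ρ : K | ∃ u β γ, IsSUnit S u ∧ IsSUnit S β ∧ γ ∈ S.integer K ∧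
      a * u ^ 3 + β = γ ^ 3 ∧ ρ = β / (a * u ^ 3)}.Finite := by
  obtain ⟨L, _, _, _, θ, ζ, hθ, hζ⟩ := exists_numberField_cube_root a
  obtain ⟨T, hT⟩ := exists_finset_finitePlace_le_one hS L
  have hT1 : ∀ w ∉ T, ∀ x, IsSUnit S x → w (algebraMap K L x) = 1 := by
    intro w hw x hx
    refine le_antisymm (hT w hw x hx.2.1) ?_
    have h := hT w hw _ hx.2.2
    rw [map_inv₀, map_inv₀] at h
    exact (inv_le_one₀ (FinitePlace.pos_iff.2 (by simpa using hx.1))).1 h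
  have hζ3 : ζ ^ 3 = 1 := by linear_combination (ζ - 1) * hζ
  have hζ0 : ζ ≠ 0 := fun h ↦ by simp [h] at hζ
  have hζ1 : ζ - 1 ≠ 0 := fun h ↦ by
    rw [sub_eq_zero.1 h] at hζ
    norm_num at hζ
  have hθ0 : θ ≠ 0 := fun h ↦ ha.1 (by
    rw [h, zero_pow three_ne_zero] at hθ
    exact (map_eq_zero _).1 hθ.symm)
  have pow_three_eq_one : ∀ r : ℝ, 0 ≤ r → r ^ 3 = 1 → r = 1 := fun r h h' ↦
    (pow_eq_one_iff_of_nonneg h (by norm_num)).1 h'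
  have hwζ : ∀ w : FinitePlace L, w ζ = 1 := fun w ↦
    pow_three_eq_one _ (apply_nonneg w ζ) (by rw [← map_pow, hζ3, map_one])
  have hwθ : ∀ w ∉ T, w θ = 1 := fun w hw ↦
    pow_three_eq_one _ (apply_nonneg w θ) (by rw [← map_pow, hθ, hT1 w hw a ha])
  refine Set.Finite.of_finite_image (f := algebraMap K L) (((finite_unitEquation T).image
    fun p ↦ ((ζ + p / ζ) / (1 + p / ζ)) ^ 3 - 1).subset ?_) (algebraMap K L).injective.injOn
  rintro _ ⟨_, ⟨u, β, γ, hu, hβ, hγ, h, rfl⟩, rfl⟩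
  set u' := algebraMap K L u with hu'
  set β' := algebraMap K L β with hβ'
  set γ' := algebraMap K L γ with hγ'
  have hu0 : u' ≠ 0 := by simpa [hu'] using hu.1
  have hβ0 : β' ≠ 0 := by simpa [hβ'] using hβ.1
  have h' : θ ^ 3 * u' ^ 3 + β' = γ' ^ 3 := by
    have := congrArg (algebraMap K L) h
    simpa [hθ] using this
  have hprod : (γ' - θ * u') * (γ' - ζ * θ * u') * (γ' - ζ ^ 2 * θ * u') = β' := by
    linear_combination (-(γ' ^ 2 * θ * u') + ζ * γ' * θ ^ 2 * u' ^ 2) * hζ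
      - θ ^ 3 * u' ^ 3 * hζ3 - h'
  have hsum : (γ' - θ * u') + ζ * (γ' - ζ * θ * u') + ζ ^ 2 * (γ' - ζ ^ 2 * θ * u') = 0 := by
    linear_combination (γ' - θ * u') * hζ - ζ * θ * u' * hζ3
  have hle : ∀ w ∉ T, ∀ z, w z = 1 → w (γ' - z * θ * u') ≤ 1 := by
    intro w hw z hz
    rw [sub_eq_add_neg]
    refine (w.add_le _ _).trans (max_le (hT w hw γ hγ) ?_)
    rw [map_neg_eq_map, map_mul, map_mul, hz, hwθ w hw, hT1 w hw u hu]
    norm_num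
  have h0 : ∀ w ∉ T, w (γ' - θ * u') = 1 ∧ w (γ' - ζ * θ * u') = 1 ∧
      w (γ' - ζ ^ 2 * θ * u') = 1 := by
    intro w hw
    refine eq_one_of_mul_mul_eq_one (apply_nonneg w _) (apply_nonneg w _) (apply_nonneg w _)
      (by simpa using hle w hw 1 (map_one w)) (hle w hw ζ (hwζ w))
      (hle w hw (ζ ^ 2) (by rw [map_pow, hwζ, one_pow])) ?_
    rw [← map_mul, ← map_mul, hprod, hT1 w hw β hβ]
  have hne : (γ' - θ * u') * (γ' - ζ * θ * u') * (γ' - ζ ^ 2 * θ * u') ≠ 0 := hprod ▸ hβ0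
  have hf3 := right_ne_zero_of_mul hne
  have hf2 := right_ne_zero_of_mul (left_ne_zero_of_mul hne)
  have hf1 := left_ne_zero_of_mul (left_ne_zero_of_mul hne)
  have hp : 1 - -(ζ * (γ' - ζ * θ * u') / (γ' - θ * u')) =
      -(ζ ^ 2 * (γ' - ζ ^ 2 * θ * u') / (γ' - θ * u')) := by
    field_simp
    linear_combination hsum
  refine ⟨-(ζ * (γ' - ζ * θ * u') / (γ' - θ * u')), ⟨?_, ?_, fun w hw ↦ ⟨?_, ?_⟩⟩, ?_⟩
  · exact neg_ne_zero.2 (div_ne_zero (mul_ne_zero hζ0 hf2) hf1)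
  · rw [hp]
    exact neg_ne_zero.2 (div_ne_zero (mul_ne_zero (pow_ne_zero _ hζ0) hf3) hf1)
  · obtain ⟨h1, h2, -⟩ := h0 w hw
    rw [map_neg_eq_map, map_div₀, map_mul, h1, h2, hwζ]
    norm_num
  · obtain ⟨h1, -, h3⟩ := h0 w hw
    rw [hp, map_neg_eq_map, map_div₀, map_mul, map_pow, h1, h3, hwζ]
    norm_num
  · have e1 : -(ζ * (γ' - ζ * θ * u') / (γ' - θ * u')) / ζ =
        -((γ' - ζ * θ * u') / (γ' - θ * u')) := by
      field_simp
    have e2 : ζ + -((γ' - ζ * θ * u') / (γ' - θ * u')) = (ζ - 1) * γ' / (γ' - θ * u') := by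
      field_simp
      ring
    have e3 : 1 + -((γ' - ζ * θ * u') / (γ' - θ * u')) = (ζ - 1) * (θ * u') / (γ' - θ * u') := by
      field_simp
      ring
    have e4 : (ζ - 1) * γ' / (γ' - θ * u') / ((ζ - 1) * (θ * u') / (γ' - θ * u')) =
        γ' / (θ * u') := by
      field_simp
    simp only [e1, e2, e3, e4, map_div₀, map_mul, map_pow, ← hθ, ← hu', ← hβ']
    field_simp
    linear_combination -h'

lemma solRel_of_cube_ratio {s t : SolSet S 3} {ε : K} (hε : IsSUnit S ε)
    (hα : t.1.1 = ε ^ 3 * s.1.1) (hβ : t.1.2.1 = ε ^ 3 * s.1.2.1) : SolRel s t := by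
  obtain ⟨⟨α, β, γ⟩, h1, h2, h3, h4⟩ := s
  obtain ⟨⟨α', β', γ'⟩, h1', h2', h3', h4'⟩ := t
  dsimp only at *
  have hγ : γ' ^ 3 = (ε * γ) ^ 3 := by
    rw [← h4', mul_pow, ← h4, hα, hβ]
    ring
  rcases eq_or_ne γ 0 with rfl | hγ0
  · refine ⟨ε, hε, hα, hβ, ?_⟩
    simpa using hγ
  have hω : (γ' / (ε * γ)) ^ 3 = 1 := by
    rw [div_pow, hγ, div_self (pow_ne_zero _ (mul_ne_zero hε.1 hγ0))]
  have hωv : ∀ v : HeightOneSpectrum (𝓞 K), v.valuation K (γ' / (ε * γ)) = 1 := fun v ↦ by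
    have h := congrArg (v.valuation K) hω
    rw [map_pow, map_one] at h
    exact (pow_eq_one_iff_left three_ne_zero).1 h
  have hωS : IsSUnit S (γ' / (ε * γ)) :=
    ⟨fun h ↦ by simp [h] at hω, fun v _ ↦ (hωv v).le, fun v _ ↦ by
      rw [map_inv₀, hωv v, inv_one]⟩
  refine ⟨γ' / (ε * γ) * ε, hωS.mul hε, ?_, ?_, ?_⟩
  · dsimp only
    rw [mul_pow, hω, one_mul, hα]
  · dsimp only
    rw [mul_pow, hω, one_mul, hβ]
  · dsimp only
    have := hε.1
    field_simp

end Finiteness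

theorem stmt_17
    (K : Type) [Field K] [NumberField K]
    (S : Set (HeightOneSpectrum (𝓞 K))) (hSfin : S.Finite) :
    -- the set of solutions of `α + β = γ³` has finitely many classes under the scaling relation
    Finite (Quot (SolRel (S := S) (i := 3))) := by
  obtain ⟨R, hRfin, hRS, hR⟩ := exists_finite_isSUnit_mod_pow (K := K) hSfin three_ne_zero
  choose a haR u hu hau using fun s : SolSet S 3 ↦ hR s.1.1 s.2.1
  let key : SolSet S 3 → K × K := fun s ↦ (a s, s.1.2.1 / s.1.1)
  have hkey : (Set.range key).Finite := by
    refine (hRfin.biUnion fun b hb ↦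
      (finite_ratios hSfin (hRS b hb)).image (Prod.mk b)).subset ?_
    rintro _ ⟨s, rfl⟩
    refine Set.mem_iUnion₂.2 ⟨a s, haR s, _, ⟨u s, s.1.2.1, s.1.2.2, hu s, s.2.2.1, s.2.2.2.1, ?_,
      rfl⟩, ?_⟩
    · rw [← hau s]
      exact s.2.2.2.2
    · simp only [key, ← hau s]
  have hrel : ∀ s t, key s = key t → SolRel s t := by
    intro s t hst
    obtain ⟨h1, h2⟩ := Prod.ext_iff.1 hst
    have hs := (hu s).1
    have hα : t.1.1 = (u t * (u s)⁻¹) ^ 3 * s.1.1 := by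
      rw [hau s, hau t, show a s = a t from h1]
      field_simp
    refine solRel_of_cube_ratio ((hu t).mul (hu s).inv) hα ?_
    have hα0 := s.2.1.1
    have hα0' := t.2.1.1
    have h3 : s.1.2.1 / s.1.1 = t.1.2.1 / t.1.1 := h2
    rw [div_eq_div_iff hα0 hα0'] at h3
    apply mul_right_cancel₀ hα0
    rw [← h3, hα]
    ring
  have := hkey.to_subtype
  refine Finite.of_surjective (fun k : Set.range key ↦ Quot.mk SolRel k.2.choose) ?_
  rintro ⟨s⟩
  exact ⟨⟨key s, s, rfl⟩, Quot.sound (hrel _ _ (⟨s, rfl⟩ : key s ∈ Set.range key).choose_spec)⟩
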